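/- Let P ⊆ ℝ² be an unbounded convex polygon (a closed convex set with nonempty interior that is an intersection of finitely many closed half-planes, having finitely many edges, exactly two of which are unbounded rays) whose two unbounded edges are not parallel. Then P is the image of a polynomial map f : ℝ² → ℝ². -/

import Mathlib

/-- A polynomial map `ℝ² → ℝ²`: both coordinate functions are given by real
polynomials in two variables. -/
def IsPolyMap (f : ℝ × ℝ → ℝ × ℝ) : Prop :=
  ∃ p q : MvPolynomial (Fin 2) ℝ, ∀ v : ℝ × ℝ,
    f v = (MvPolynomial.eval ![v.1, v.2] p, MvPolynomial.eval ![v.1, v.2] q)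

/-- The recession cone of a planar set. -/
def recessionCone (P : Set (ℝ × ℝ)) : Set (ℝ × ℝ) :=
  {d | ∀ p ∈ P, ∀ t : ℝ, 0 ≤ t → p + t • d ∈ P}

/-- A `V`-polygon: an unbounded convex polygon (finite intersection of closed
half-planes with nonempty interior) whose two unbounded edges are nonparallel,
i.e. whose recession cone is spanned by two linearly independent vectors. -/
def IsVPolygon (P : Set (ℝ × ℝ)) : Prop :=
  (∃ (n : ℕ) (a b c : Fin n → ℝ), (∀ i, (a i, b i) ≠ (0, 0)) ∧
    P = {p : ℝ × ℝ | ∀ i, 0 ≤ a i * p.1 + b i * p.2 + c i}) ∧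
  (interior P).Nonempty ∧
  ∃ v w : ℝ × ℝ, LinearIndependent ℝ ![v, w] ∧
    recessionCone P = {d | ∃ s t : ℝ, 0 ≤ s ∧ 0 ≤ t ∧ d = s • v + t • w}

open Filter Finset

/-- A real-valued function on the plane given by a polynomial in two variables. -/
def IsPolyFun (g : ℝ × ℝ → ℝ) : Prop :=
  ∃ p : MvPolynomial (Fin 2) ℝ, ∀ v : ℝ × ℝ, g v = MvPolynomial.eval ![v.1, v.2] p

namespace IsPolyFun

theorem const (c : ℝ) : IsPolyFun fun _ => c := ⟨.C c, by simp⟩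

theorem fst : IsPolyFun fun v => v.1 := ⟨.X 0, by simp⟩

theorem snd : IsPolyFun fun v => v.2 := ⟨.X 1, by simp⟩

theorem add {g h : ℝ × ℝ → ℝ} (hg : IsPolyFun g) (hh : IsPolyFun h) :
    IsPolyFun fun v => g v + h v := by
  obtain ⟨p, hp⟩ := hg
  obtain ⟨q, hq⟩ := hh
  exact ⟨p + q, by simp [hp, hq]⟩

theorem mul {g h : ℝ × ℝ → ℝ} (hg : IsPolyFun g) (hh : IsPolyFun h) :
    IsPolyFun fun v => g v * h v := by
  obtain ⟨p, hp⟩ := hg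
  obtain ⟨q, hq⟩ := hh
  exact ⟨p * q, by simp [hp, hq]⟩

theorem sub {g h : ℝ × ℝ → ℝ} (hg : IsPolyFun g) (hh : IsPolyFun h) :
    IsPolyFun fun v => g v - h v := by
  obtain ⟨p, hp⟩ := hg
  obtain ⟨q, hq⟩ := hh
  exact ⟨p - q, by simp [hp, hq]⟩

theorem pow {g : ℝ × ℝ → ℝ} (hg : IsPolyFun g) (n : ℕ) : IsPolyFun fun v => g v ^ n := by
  obtain ⟨p, hp⟩ := hg
  exact ⟨p ^ n, by simp [hp]⟩

theorem prod {ι : Type*} (s : Finset ι) {g : ι → ℝ × ℝ → ℝ} (hg : ∀ i, IsPolyFun (g i)) :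
    IsPolyFun fun v => ∏ i ∈ s, g i v := by
  choose p hp using hg
  exact ⟨∏ i ∈ s, p i, by simp [hp, map_prod]⟩

theorem comp {g : ℝ × ℝ → ℝ} {f : ℝ × ℝ → ℝ × ℝ} (hg : IsPolyFun g) (hf : IsPolyMap f) :
    IsPolyFun fun v => g (f v) := by
  obtain ⟨r, hr⟩ := hg
  obtain ⟨p, q, hf⟩ := hf
  refine ⟨MvPolynomial.bind₁ ![p, q] r, fun v => ?_⟩
  simp only [hr, hf, ← MvPolynomial.coe_aeval_eq_eval]
  simp only [RingHom.coe_coe]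
  rw [MvPolynomial.aeval_bind₁]
  congr 2
  funext i
  fin_cases i <;> simp [MvPolynomial.aeval_eq_eval]

theorem isPolyMap {g h : ℝ × ℝ → ℝ} (hg : IsPolyFun g) (hh : IsPolyFun h) :
    IsPolyMap fun v => (g v, h v) := by
  obtain ⟨p, hp⟩ := hg
  obtain ⟨q, hq⟩ := hh
  exact ⟨p, q, fun v => by simp only [hp, hq]⟩

end IsPolyFun

/-- A planar set that is the image of a polynomial map. -/
def IsPolyImage (S : Set (ℝ × ℝ)) : Prop :=
  ∃ f : ℝ × ℝ → ℝ × ℝ, IsPolyMap f ∧ Set.range f = S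

theorem IsPolyImage.image {S : Set (ℝ × ℝ)} {g h : ℝ × ℝ → ℝ} (hS : IsPolyImage S)
    (hg : IsPolyFun g) (hh : IsPolyFun h) : IsPolyImage ((fun v => (g v, h v)) '' S) := by
  obtain ⟨f, hf, rfl⟩ := hS
  exact ⟨_, (hg.comp hf).isPolyMap (hh.comp hf), Set.range_comp (fun v => (g v, h v)) f⟩

theorem le_fold {b x c : ℝ} (hb : b ≤ x) (hc : 0 ≤ c) : x ≤ b + (x - b) * (1 + c) ^ 2 := by
  nlinarith [mul_nonneg (sub_nonneg.2 hb) hc, mul_nonneg (sub_nonneg.2 hb) (mul_nonneg hc hc)]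

/-- The fold `x ↦ b + (x - b) (1 + p x)²` fixes `u` and reaches everything above it. -/
theorem exists_fold_eq_of_nonneg {p : ℝ → ℝ} (hp : Continuous p) {b u z : ℝ} (hb : b ≤ u)
    (hu : p u = 0) (hz : u ≤ z) (hpz : 0 ≤ p z) :
    ∃ x, u ≤ x ∧ b + (x - b) * (1 + p x) ^ 2 = z := by
  have hc : ContinuousOn (fun x => b + (x - b) * (1 + p x) ^ 2) (Set.Icc u z) := by fun_prop
  obtain ⟨x, hx, h⟩ := intermediate_value_Icc hz hc
    (show z ∈ Set.Icc _ _ from ⟨by simp [hu, hz], le_fold (hb.trans hz) hpz⟩)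
  exact ⟨x, hx.1, h⟩

/-- If `p` becomes very negative, the fold maps the half-line above `u` onto `[b, ∞)`. -/
theorem exists_fold_eq_of_eventually {p : ℝ → ℝ} (hp : Continuous p) {b u z : ℝ} (hb : b ≤ u)
    (hu : p u = 0) (hz : b ≤ z) (hev : ∀ᶠ x in atTop, p x ≤ -2) :
    ∃ x, u < x ∧ b + (x - b) * (1 + p x) ^ 2 = z := by
  obtain ⟨y, hy, hyu, hyz⟩ := (hev.and ((eventually_ge_atTop u).and (eventually_ge_atTop z))).exists
  obtain ⟨r, hr, hpr⟩ := intermediate_value_Icc' hyu hp.continuousOn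
    (show (-1 : ℝ) ∈ Set.Icc _ _ from ⟨by linarith, by linarith⟩)
  have hur : u < r := lt_of_le_of_ne hr.1 (by rintro rfl; linarith)
  have hc : ContinuousOn (fun x => b + (x - b) * (1 + p x) ^ 2) (Set.Icc r y) := by fun_prop
  obtain ⟨x, hx, h⟩ := intermediate_value_Icc hr.2 hc
    (show z ∈ Set.Icc _ _ from ⟨by simp [hpr, hz], by
      have : 1 ≤ (1 + p y) ^ 2 := by nlinarith
      nlinarith [mul_nonneg (sub_nonneg.2 (hb.trans hyu)) (sub_nonneg.2 this)]⟩)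
  exact ⟨x, hur.trans_le hx.1, h⟩

theorem eventually_mul_prod_le {ι : Type*} (s : Finset ι) {k : ℝ} (hk : k < 0) (q : ℝ)
    {f : ι → ℝ → ℝ} (hf : ∀ i ∈ s, Tendsto (f i) atTop atTop) :
    ∀ᶠ x in atTop, k * ((x - q) ^ 2 * ∏ i ∈ s, f i x ^ 2) ≤ -2 := by
  have h : ∀ᶠ x in atTop, ∀ i ∈ s, 1 ≤ f i x :=
    (eventually_all_finset s).2 fun i hi => (hf i hi).eventually_ge_atTop 1
  filter_upwards [h, eventually_ge_atTop (q + 1), eventually_ge_atTop (q + 2 / -k)] with x hx h1 h2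
  have hP : 1 ≤ ∏ i ∈ s, f i x ^ 2 :=
    Finset.prod_induction _ (fun t => (1 : ℝ) ≤ t) (fun _ _ => one_le_mul_of_one_le_of_one_le)
      le_rfl fun i hi => one_le_pow₀ (hx i hi)
  have h3 : 2 ≤ (x - q) * -k := (div_le_iff₀ (by linarith)).1 (by linarith)
  have h4 : 2 ≤ -k * (x - q) ^ 2 := by nlinarith
  nlinarith [mul_nonneg (by linarith : 0 ≤ -k * (x - q) ^ 2) (sub_nonneg.2 hP)]

/-- The points to the right of `x = a` and above the lines `y = l.1 * x + l.2`, `l ∈ T`. -/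
def regionAbove (a : ℝ) (T : Finset (ℝ × ℝ)) : Set (ℝ × ℝ) :=
  {p | a ≤ p.1 ∧ ∀ l ∈ T, l.1 * p.1 + l.2 ≤ p.2}

/-- Lines of large slope `m` meet `regionAbove q T` in half-lines, whose end points are zeros of
the polynomial defining the boundary. -/
theorem exists_oblique_bottom (q m s : ℝ) {T : Finset (ℝ × ℝ)} (hT : T.Nonempty)
    (hm : ∀ l ∈ T, l.1 < m) :
    ∃ u, q ≤ u ∧ (u - q) ^ 2 * ∏ l ∈ T, (s + m * u - (l.1 * u + l.2)) ^ 2 = 0 ∧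
      ∀ x, (x, s + m * x) ∈ regionAbove q T ↔ u ≤ x := by
  obtain ⟨k, hk, hmax⟩ := T.exists_max_image (fun l => (l.2 - s) / (m - l.1)) hT
  refine ⟨max q ((k.2 - s) / (m - k.1)), le_max_left _ _, ?_, fun x => ?_⟩
  · rcases max_choice q ((k.2 - s) / (m - k.1)) with h | h <;> rw [h]
    · simp
    · rw [Finset.prod_eq_zero hk, mul_zero]
      have := (sub_pos.2 (hm k hk)).ne'
      field_simp
      ring
  · have key : ∀ l ∈ T, (l.1 * x + l.2 ≤ s + m * x ↔ (l.2 - s) / (m - l.1) ≤ x) := fun l hl => by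
      rw [div_le_iff₀ (sub_pos.2 (hm l hl))]
      constructor <;> intro h <;> linarith
    simp only [regionAbove, Set.mem_ofPred_eq, max_le_iff]
    refine and_congr_right fun _ => ⟨fun h => (key k hk).1 (h k hk), fun h l hl => ?_⟩
    exact (key l hl).2 ((hmax l hl).trans h)

/-- Folding along lines of slope `m` over the line `x = a`. -/
theorem image_oblique_fold {a q m Y : ℝ} (haq : a < q) {T : Finset (ℝ × ℝ)} (hT : T.Nonempty)
    (hm : ∀ l ∈ T, l.1 < m) :
    let t : ℝ × ℝ → ℝ := fun v => a + (v.1 - a) * (1 + (Y - (v.2 - m * v.1)) *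
      ((v.1 - q) ^ 2 * ∏ l ∈ T, (v.2 - m * v.1 + m * v.1 - (l.1 * v.1 + l.2)) ^ 2)) ^ 2
    (fun v => (t v, v.2 + m * (t v - v.1))) '' regionAbove q T =
      regionAbove q T ∪ {v | a ≤ v.1 ∧ m * v.1 + Y < v.2} := by
  intro t
  ext ⟨x', y'⟩
  constructor
  · rintro ⟨⟨x, y⟩, hxy, heq⟩
    obtain ⟨h1, h2⟩ := Prod.mk.inj heq
    simp only at h2
    have hqx : q ≤ x := hxy.1
    rw [h1] at h2
    rcases le_or_gt (y - m * x) Y with hs | hs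
    · have hx : x ≤ x' := by
        have hp : 0 ≤ (Y - (y - m * x)) *
            ((x - q) ^ 2 * ∏ l ∈ T, (y - m * x + m * x - (l.1 * x + l.2)) ^ 2) :=
          mul_nonneg (sub_nonneg.2 hs)
            (mul_nonneg (sq_nonneg _) (Finset.prod_nonneg fun _ _ => sq_nonneg _))
        rw [← h1]
        exact le_fold (haq.le.trans hqx) hp
      refine Or.inl ⟨hqx.trans hx, fun l hl => ?_⟩
      have := hxy.2 l hl
      simp only at this ⊢
      nlinarith [mul_nonneg (sub_nonneg.2 hx) (sub_nonneg.2 (hm l hl).le)]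
    · refine Or.inr ⟨?_, ?_⟩
      · simp only
        rw [← h1]
        exact le_add_of_nonneg_right (mul_nonneg (by simp only; linarith) (sq_nonneg _))
      · simp only
        linarith
  · intro h
    obtain ⟨u, hqu, hu0, hu⟩ := exists_oblique_bottom q m (y' - m * x') hT hm
    set p : ℝ → ℝ := fun x => (Y - (y' - m * x')) *
      ((x - q) ^ 2 * ∏ l ∈ T, (y' - m * x' + m * x - (l.1 * x + l.2)) ^ 2) with hp_def
    have hp : Continuous p := by fun_prop
    have hpu : p u = 0 := by simp only [hp_def, hu0, mul_zero]
    suffices ∃ x, u ≤ x ∧ a + (x - a) * (1 + p x) ^ 2 = x' by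
      obtain ⟨x, hx, hxx⟩ := this
      have ht : t (x, y' - m * x' + m * x) = x' := by
        simp only [t, add_sub_cancel_right]
        exact hxx
      refine ⟨(x, y' - m * x' + m * x), (hu x).2 hx, ?_⟩
      simp only [ht, Prod.mk.injEq, true_and]
      ring
    rcases le_or_gt (y' - m * x') Y with hs | hs
    · have hmem : (x', y') ∈ regionAbove q T := by
        rcases h with h | h
        · exact h
        · have := h.2
          simp only at this
          linarith
      refine exists_fold_eq_of_nonneg hp (haq.le.trans hqu) hpu ((hu x').1 (by simpa using hmem)) ?_
      exact mul_nonneg (sub_nonneg.2 hs)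
        (mul_nonneg (sq_nonneg _) (Finset.prod_nonneg fun _ _ => sq_nonneg _))
    · have hax : a ≤ x' := by
        rcases h with h | h
        · exact haq.le.trans h.1
        · exact h.1
      obtain ⟨x, hx, hxx⟩ := exists_fold_eq_of_eventually hp (haq.le.trans hqu) hpu hax
        (eventually_mul_prod_le T (by linarith) q fun l hl => by
          have : Tendsto (fun x : ℝ => (m - l.1) * x + (y' - m * x' - l.2)) atTop atTop :=
            tendsto_atTop_add_const_right _ _ (tendsto_id.const_mul_atTop (sub_pos.2 (hm l hl)))
          refine this.congr fun x => ?_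
          ring)
      exact ⟨x, hx.le, hxx⟩

/-- Folding vertically over the line `y = k.1 * x + k.2`. -/
theorem image_vertical_fold {a q m Y : ℝ} (haq : a < q) {T : Finset (ℝ × ℝ)} {k k' : ℝ × ℝ}
    (hm : ∀ l ∈ T, l.1 < m) (hkm : k.1 < m)
    (hY : ∀ l ∈ T, l.1 * a + l.2 ≤ m * a + Y) (hkY : k.1 * a + k.2 ≤ m * a + Y)
    (hleft : ∀ x < q, ∀ l ∈ T, l.1 * x + l.2 ≤ k.1 * x + k.2)
    (hk' : k' ∈ T) (hright : ∀ x, q ≤ x → k.1 * x + k.2 ≤ k'.1 * x + k'.2) :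
    (fun v : ℝ × ℝ => (v.1, k.1 * v.1 + k.2 + (v.2 - (k.1 * v.1 + k.2)) * (1 + (v.1 - q) *
      ((v.2 - (m * v.1 + Y)) ^ 2 * ∏ l ∈ T, (v.2 - (l.1 * v.1 + l.2)) ^ 2)) ^ 2)) ''
      (regionAbove q T ∪ {v | a ≤ v.1 ∧ m * v.1 + Y < v.2}) = regionAbove a (insert k T) := by
  have steep : ∀ l : ℝ × ℝ, l.1 < m → l.1 * a + l.2 ≤ m * a + Y → ∀ x, a ≤ x →
      l.1 * x + l.2 ≤ m * x + Y := fun l h1 h2 x hx => by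
    nlinarith [mul_nonneg (sub_nonneg.2 hx) (sub_nonneg.2 h1.le)]
  ext ⟨x, y'⟩
  constructor
  · rintro ⟨⟨x₁, y⟩, hxy, heq⟩
    obtain ⟨h1, h2⟩ := Prod.mk.inj heq
    simp only at h1 h2
    subst h1
    have hax : a ≤ x₁ := by
      rcases hxy with h | h
      · exact haq.le.trans h.1
      · exact h.1
    rcases lt_or_ge x₁ q with hx | hx
    · have hy : m * x₁ + Y < y := by
        rcases hxy with h | h
        · exact absurd h.1 (not_le.2 hx)
        · exact h.2
      have hky := steep k hkm hkY x₁ hax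
      have hkl : k.1 * x₁ + k.2 ≤ y' := by
        rw [← h2]
        exact le_add_of_nonneg_right (mul_nonneg (by linarith) (sq_nonneg _))
      refine ⟨hax, fun l hl => ?_⟩
      rcases Finset.mem_insert.1 hl with rfl | hl
      · exact hkl
      · exact (hleft _ hx l hl).trans hkl
    · have hTy : ∀ l ∈ T, l.1 * x₁ + l.2 ≤ y := fun l hl => by
        rcases hxy with h | h
        · exact h.2 l hl
        · exact (steep l (hm l hl) (hY l hl) x₁ hax).trans h.2.le
      have hky := (hright x₁ hx).trans (hTy k' hk')
      have hyy : y ≤ y' := by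
        have hp : 0 ≤ (x₁ - q) *
            ((y - (m * x₁ + Y)) ^ 2 * ∏ l ∈ T, (y - (l.1 * x₁ + l.2)) ^ 2) :=
          mul_nonneg (sub_nonneg.2 hx)
            (mul_nonneg (sq_nonneg _) (Finset.prod_nonneg fun _ _ => sq_nonneg _))
        rw [← h2]
        exact le_fold hky hp
      refine ⟨hax, fun l hl => ?_⟩
      rcases Finset.mem_insert.1 hl with rfl | hl
      · exact hky.trans hyy
      · exact (hTy l hl).trans hyy
  · rintro ⟨hax, hl⟩
    simp only at hax hl
    set p : ℝ → ℝ := fun y => (x - q) *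
      ((y - (m * x + Y)) ^ 2 * ∏ l ∈ T, (y - (l.1 * x + l.2)) ^ 2) with hp_def
    have hp : Continuous p := by fun_prop
    suffices ∃ y, (x, y) ∈ regionAbove q T ∪ {v | a ≤ v.1 ∧ m * v.1 + Y < v.2} ∧
        k.1 * x + k.2 + (y - (k.1 * x + k.2)) * (1 + p y) ^ 2 = y' by
      obtain ⟨y, hy, hyy⟩ := this
      exact ⟨(x, y), hy, Prod.ext rfl hyy⟩
    rcases lt_or_ge x q with hx | hx
    · obtain ⟨y, hy, hyy⟩ := exists_fold_eq_of_eventually hp (steep k hkm hkY x hax)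
        (by simp [hp_def]) (hl k (Finset.mem_insert_self _ _))
        (eventually_mul_prod_le T (by linarith) (m * x + Y) fun l _ => by
          simpa only [sub_eq_add_neg, id] using
            tendsto_atTop_add_const_right atTop (-(l.1 * x + l.2)) tendsto_id)
      exact ⟨y, Or.inr ⟨hax, hy⟩, hyy⟩
    · obtain ⟨j, hj, hmax⟩ := T.exists_max_image (fun l => l.1 * x + l.2) ⟨k', hk'⟩
      obtain ⟨y, hy, hyy⟩ := exists_fold_eq_of_nonneg (u := j.1 * x + j.2) hp
        ((hright x hx).trans (hmax k' hk'))
        (by simp only [hp_def]; rw [Finset.prod_eq_zero hj (by simp)]; simp)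
        (hl j (Finset.mem_insert_of_mem hj))
        (mul_nonneg (sub_nonneg.2 hx)
            (mul_nonneg (sq_nonneg _) (Finset.prod_nonneg fun _ _ => sq_nonneg _)))
      exact ⟨y, Or.inl ⟨hx, fun l h => (hmax l h).trans hy⟩, hyy⟩

theorem regionAbove_erase {a : ℝ} {T : Finset (ℝ × ℝ)} {l l' : ℝ × ℝ} (hl' : l' ∈ T)
    (hne : l ≠ l') (h : ∀ x, a ≤ x → l.1 * x + l.2 ≤ l'.1 * x + l'.2) :
    regionAbove a (T.erase l) = regionAbove a T := by
  ext p
  refine and_congr_right fun hp => ⟨fun H j hj => ?_, fun H j hj => H j (Finset.mem_of_mem_erase hj)⟩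
  by_cases hjl : j = l
  · subst hjl
    exact (h _ hp).trans (H l' (Finset.mem_erase.2 ⟨hne.symm, hl'⟩))
  · exact H j (Finset.mem_erase.2 ⟨hjl, hj⟩)

theorem isPolyImage_regionAbove_singleton (a : ℝ) (k : ℝ × ℝ) :
    IsPolyImage (regionAbove a {k}) := by
  refine ⟨fun v => (a + v.1 ^ 2, k.1 * (a + v.1 ^ 2) + k.2 + v.2 ^ 2), ?_, ?_⟩
  · have h : IsPolyFun fun v => a + v.1 ^ 2 := (IsPolyFun.const a).add (IsPolyFun.fst.pow 2)
    exact h.isPolyMap ((((IsPolyFun.const _).mul h).add (.const _)).add (IsPolyFun.snd.pow 2))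
  · ext ⟨x, y⟩
    simp only [Set.mem_range, Prod.mk.injEq, regionAbove, Finset.mem_singleton, forall_eq,
      Set.mem_ofPred_eq]
    constructor
    · rintro ⟨v, rfl, rfl⟩
      exact ⟨le_add_of_nonneg_right (sq_nonneg _), le_add_of_nonneg_right (sq_nonneg _)⟩
    · rintro ⟨hx, hy⟩
      have h1 : a + √(x - a) ^ 2 = x := by rw [Real.sq_sqrt (sub_nonneg.2 hx)]; ring
      refine ⟨(√(x - a), √(y - (k.1 * x + k.2))), h1, ?_⟩
      simp only [h1]
      rw [Real.sq_sqrt (sub_nonneg.2 hy)]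
      ring

/-- Adding an edge: the region cut out by `x = a` and a line of smallest slope is obtained by
folding from the region with these two edges replaced by `x = q`. -/
theorem IsPolyImage.insert_edge {a q : ℝ} (haq : a < q) {T : Finset (ℝ × ℝ)} {k k' : ℝ × ℝ}
    (hleft : ∀ x < q, ∀ l ∈ T, l.1 * x + l.2 ≤ k.1 * x + k.2)
    (hk' : k' ∈ T) (hright : ∀ x, q ≤ x → k.1 * x + k.2 ≤ k'.1 * x + k'.2)
    (hQ : IsPolyImage (regionAbove q T)) : IsPolyImage (regionAbove a (insert k T)) := by
  obtain ⟨M, hM⟩ := ((insert k T).image Prod.fst).exists_le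
  obtain ⟨Y, hY⟩ := ((insert k T).image fun l => l.1 * a + l.2 - (M + 1) * a).exists_le
  simp only [Finset.forall_mem_image] at hM hY
  have hm : ∀ l ∈ insert k T, l.1 < M + 1 := fun l hl => by linarith [hM hl]
  have hY' : ∀ l ∈ insert k T, l.1 * a + l.2 ≤ (M + 1) * a + Y := fun l hl => by linarith [hY hl]
  have hmT : ∀ l ∈ T, l.1 < M + 1 := fun l hl => hm l (Finset.mem_insert_of_mem hl)
  have lin : ∀ c d : ℝ, IsPolyFun fun v => c * v.1 + d := fun c d =>
    ((IsPolyFun.const c).mul .fst).add (.const d)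
  have hs : IsPolyFun fun v => v.2 - (M + 1) * v.1 :=
    IsPolyFun.snd.sub ((IsPolyFun.const _).mul .fst)
  rw [← image_vertical_fold haq hmT (hm k (Finset.mem_insert_self _ _))
    (fun l hl => hY' l (Finset.mem_insert_of_mem hl)) (hY' k (Finset.mem_insert_self _ _))
    hleft hk' hright, ← image_oblique_fold haq ⟨k', hk'⟩ hmT]
  have ht := (IsPolyFun.const a).add ((IsPolyFun.fst.sub (.const a)).mul
    (((IsPolyFun.const 1).add (((IsPolyFun.const Y).sub hs).mul
      (((IsPolyFun.fst.sub (.const q)).pow 2).mul (IsPolyFun.prod T fun l =>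
        ((hs.add ((IsPolyFun.const (M + 1)).mul .fst)).sub (lin l.1 l.2)).pow 2)))).pow 2))
  refine IsPolyImage.image (hQ.image ht
    (IsPolyFun.snd.add ((IsPolyFun.const _).mul (ht.sub .fst)))) .fst ?_
  exact (lin _ _).add ((IsPolyFun.snd.sub (lin _ _)).mul
    (((IsPolyFun.const 1).add ((IsPolyFun.fst.sub (.const q)).mul
      (((IsPolyFun.snd.sub (lin _ _)).pow 2).mul
        (IsPolyFun.prod T fun l => (IsPolyFun.snd.sub (lin l.1 l.2)).pow 2)))).pow 2))

theorem isPolyImage_regionAbove (T : Finset (ℝ × ℝ)) (hT : T.Nonempty) (a : ℝ) :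
    IsPolyImage (regionAbove a T) := by
  induction T using Finset.strongInduction generalizing a with
  | H T ih =>
  have redundant : ∀ l ∈ T, ∀ l' ∈ T, l ≠ l' →
      (∀ x, a ≤ x → l.1 * x + l.2 ≤ l'.1 * x + l'.2) → IsPolyImage (regionAbove a T) :=
    fun l hl l' hl' hne h => by
      rw [← regionAbove_erase hl' hne h]
      exact ih _ (Finset.erase_ssubset hl) ⟨l', Finset.mem_erase.2 ⟨hne.symm, hl'⟩⟩ a
  obtain ⟨k, hk, hmin⟩ := T.exists_min_image Prod.fst hT
  rcases (T.erase k).eq_empty_or_nonempty with h0 | hne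
  · rw [← Finset.insert_erase hk, h0]
    exact isPolyImage_regionAbove_singleton a k
  by_cases hpar : ∃ l ∈ T.erase k, l.1 = k.1
  · obtain ⟨l, hl, hlk⟩ := hpar
    obtain ⟨hlne, hlT⟩ := Finset.mem_erase.1 hl
    rcases le_total l.2 k.2 with h | h
    · exact redundant l hlT k hk hlne fun x _ => by rw [hlk]; linarith
    · exact redundant k hk l hlT hlne.symm fun x _ => by rw [hlk]; linarith
  push Not at hpar
  have hlt : ∀ l ∈ T.erase k, k.1 < l.1 := fun l hl =>
    lt_of_le_of_ne (hmin l (Finset.mem_of_mem_erase hl)) (hpar l hl).symm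
  obtain ⟨k', hk', hcross⟩ :=
    (T.erase k).exists_min_image (fun l => (k.2 - l.2) / (l.1 - k.1)) hne
  have hright : ∀ x, (k.2 - k'.2) / (k'.1 - k.1) ≤ x → k.1 * x + k.2 ≤ k'.1 * x + k'.2 :=
    fun x hx => by
      rw [div_le_iff₀ (sub_pos.2 (hlt k' hk'))] at hx
      linarith
  obtain ⟨hkne, hkT⟩ := Finset.mem_erase.1 hk'
  rcases le_or_gt ((k.2 - k'.2) / (k'.1 - k.1)) a with hqa | haq
  · exact redundant k hk k' hkT hkne.symm fun x hx => hright x (hqa.trans hx)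
  · rw [← Finset.insert_erase hk]
    refine IsPolyImage.insert_edge haq (fun x hx l hl => ?_) hk' hright
      (ih _ (Finset.erase_ssubset hk) hne _)
    have := hx.le.trans (hcross l hl)
    rw [le_div_iff₀ (sub_pos.2 (hlt l hl))] at this
    linarith

/-- A polygon whose recession cone is the first quadrant, up to the shape of its equations. -/
theorem exists_eq_regionAbove {n : ℕ} {α β c : Fin n → ℝ} (hβ : ∀ i, 0 ≤ β i)
    (hne : ∀ i, β i = 0 → 0 < α i) (h0 : ∃ i, β i = 0) (h1 : ∃ i, 0 < β i) :
    ∃ (a : ℝ) (T : Finset (ℝ × ℝ)), T.Nonempty ∧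
      {p : ℝ × ℝ | ∀ i, 0 ≤ α i * p.1 + β i * p.2 + c i} = regionAbove a T := by
  classical
  obtain ⟨i₀, hi₀⟩ := h0
  obtain ⟨i₁, hi₁⟩ := h1
  obtain ⟨j, hj, hmax⟩ := (univ.filter fun i => β i = 0).exists_max_image
    (fun i => -c i / α i) ⟨i₀, by simpa using hi₀⟩
  simp only [Finset.mem_filter, Finset.mem_univ, true_and] at hj hmax
  refine ⟨-c j / α j, (univ.filter fun i => 0 < β i).image fun i => (-α i / β i, -c i / β i),
    ⟨_, Finset.mem_image_of_mem _ (by simpa using hi₁)⟩, ?_⟩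
  have hv : ∀ i, β i = 0 → ∀ x y : ℝ, (0 ≤ α i * x + β i * y + c i ↔ -c i / α i ≤ x) :=
    fun i hi x y => by
      rw [hi, div_le_iff₀ (hne i hi)]
      constructor <;> intro h <;> linarith
  have hs : ∀ i, 0 < β i → ∀ x y : ℝ,
      (0 ≤ α i * x + β i * y + c i ↔ -α i / β i * x + -c i / β i ≤ y) := fun i hi x y => by
    rw [show -α i / β i * x + -c i / β i = (-α i * x - c i) / β i by ring, div_le_iff₀ hi]
    constructor <;> intro h <;> linarith
  ext ⟨x, y⟩
  simp only [regionAbove, Set.mem_ofPred_eq, Finset.forall_mem_image, Finset.mem_filter,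
    Finset.mem_univ, true_and]
  constructor
  · exact fun h => ⟨(hv j hj x y).1 (h j), fun i hi => (hs i hi x y).1 (h i)⟩
  · rintro ⟨h, h'⟩ i
    rcases (hβ i).eq_or_lt with hi | hi
    · exact (hv i hi.symm x y).2 ((hmax i hi.symm).trans h)
    · exact (hs i hi x y).2 (h' hi)

theorem det_ne_zero_of_linearIndependent {v w : ℝ × ℝ} (h : LinearIndependent ℝ ![v, w]) :
    v.1 * w.2 - v.2 * w.1 ≠ 0 := by
  rw [LinearIndependent.pair_iff] at h
  intro hD
  have h1 := h w.2 (-v.2) (by ext <;> simp <;> linarith)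
  have h2 := h w.1 (-v.1) (by ext <;> simp <;> linarith)
  have hv : v = 0 := by ext <;> simp <;> linarith [h1.2, h2.2]
  simpa using h 1 0 (by simp [hv])

theorem nonneg_of_forall_nonneg_add_mul {A B : ℝ} (h : ∀ t : ℝ, 0 ≤ t → 0 ≤ A + t * B) :
    0 ≤ B := by
  by_contra! hB
  have := h ((|A| + 1) / -B) (div_nonneg (by positivity) (by linarith))
  rw [show (|A| + 1) / -B * B = -(|A| + 1) by
    have := hB.ne
    field_simp] at this
  linarith [le_abs_self A]

theorem stmt_8 (P : Set (ℝ × ℝ)) (hP : IsVPolygon P) :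
    ∃ f : ℝ × ℝ → ℝ × ℝ, IsPolyMap f ∧ Set.range f = P := by
  obtain ⟨⟨n, a, b, c, hab, hPeq⟩, hint, v, w, hvw, hrec⟩ := hP
  obtain ⟨p₀, hp₀⟩ := hint.mono interior_subset
  have hD := det_ne_zero_of_linearIndependent hvw
  have mem_rec : ∀ d : ℝ × ℝ, d ∈ recessionCone P ↔ ∀ i, 0 ≤ a i * d.1 + b i * d.2 := by
    intro d
    constructor
    · intro hd i
      refine nonneg_of_forall_nonneg_add_mul (A := a i * p₀.1 + b i * p₀.2 + c i) fun t ht => ?_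
      have := hd p₀ hp₀ t ht
      rw [hPeq] at this
      have := this i
      simp only [Prod.fst_add, Prod.snd_add, Prod.smul_fst, Prod.smul_snd, smul_eq_mul] at this
      linarith
    · intro hd p hp t ht
      rw [hPeq] at hp ⊢
      intro i
      simp only [Prod.fst_add, Prod.snd_add, Prod.smul_fst, Prod.smul_snd, smul_eq_mul]
      nlinarith [hp i, mul_nonneg ht (hd i)]
  have hβ : ∀ i, 0 ≤ a i * v.1 + b i * v.2 :=
    (mem_rec v).1 (hrec ▸ ⟨1, 0, by simp, le_rfl, by simp⟩)
  have hα : ∀ i, 0 ≤ a i * w.1 + b i * w.2 :=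
    (mem_rec w).1 (hrec ▸ ⟨0, 1, le_rfl, by simp, by simp⟩)
  have coeff_nonneg : ∀ s t : ℝ, (∀ i, 0 ≤ s * (a i * v.1 + b i * v.2) +
      t * (a i * w.1 + b i * w.2)) → 0 ≤ s ∧ 0 ≤ t := by
    intro s t h
    have hmem : s • v + t • w ∈ recessionCone P := (mem_rec _).2 fun i => by
      simp only [Prod.fst_add, Prod.snd_add, Prod.smul_fst, Prod.smul_snd, smul_eq_mul]
      linarith [h i]
    rw [hrec] at hmem
    obtain ⟨s', t', hs', ht', heq⟩ := hmem
    have := LinearIndependent.pair_iff.1 hvw (s - s') (t - t') (by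
      rw [sub_smul, sub_smul, ← sub_eq_zero.2 heq]; abel)
    constructor <;> linarith [this.1, this.2]
  have hne : ∀ i, a i * v.1 + b i * v.2 = 0 → 0 < a i * w.1 + b i * w.2 := by
    intro i hi
    refine lt_of_le_of_ne (hα i) fun hi' => hab i ?_
    refine Prod.ext (mul_right_cancel₀ hD ?_) (mul_right_cancel₀ hD ?_)
    · linear_combination w.2 * hi + v.2 * hi'
    · linear_combination (-w.1) * hi - v.1 * hi'
  have h1 : ∃ i, 0 < a i * v.1 + b i * v.2 := by
    by_contra! h
    have := (coeff_nonneg (-1) 0 fun i => by linarith [h i]).1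
    linarith
  have h0 : ∃ i, a i * v.1 + b i * v.2 = 0 := by
    by_contra! h
    obtain ⟨N, hN⟩ := (univ.image fun i =>
      (a i * w.1 + b i * w.2) / (a i * v.1 + b i * v.2)).exists_le
    simp only [Finset.forall_mem_image] at hN
    have := (coeff_nonneg N (-1) fun i => by
      have := hN (Finset.mem_univ i)
      rw [div_le_iff₀ (lt_of_le_of_ne (hβ i) (h i).symm)] at this
      linarith).2
    linarith
  obtain ⟨q, T, hT, hreg⟩ := exists_eq_regionAbove (c := c) hβ hne h0 h1
  have himg := (isPolyImage_regionAbove T hT q).image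
    ((IsPolyFun.fst.mul (.const w.1)).add (IsPolyFun.snd.mul (.const v.1)))
    ((IsPolyFun.fst.mul (.const w.2)).add (IsPolyFun.snd.mul (.const v.2)))
  change IsPolyImage P
  convert himg
  rw [← hreg, hPeq]
  ext ⟨x, y⟩
  simp only [Set.mem_image, Set.mem_ofPred_eq, Prod.exists, Prod.mk.injEq]
  constructor
  · intro h
    have hx : (v.1 * y - v.2 * x) / (v.1 * w.2 - v.2 * w.1) * w.1 +
        (w.2 * x - w.1 * y) / (v.1 * w.2 - v.2 * w.1) * v.1 = x := by field_simp; ring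
    have hy : (v.1 * y - v.2 * x) / (v.1 * w.2 - v.2 * w.1) * w.2 +
        (w.2 * x - w.1 * y) / (v.1 * w.2 - v.2 * w.1) * v.2 = y := by field_simp; ring
    refine ⟨_, _, fun i => ?_, hx, hy⟩
    convert h i using 1
    linear_combination a i * hx + b i * hy
  · rintro ⟨s, t, h, rfl, rfl⟩ i
    linarith [h i]
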